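/- arXiv:1701.08034 — 3 statements merged into one kernel-verified Lean document; each statement's English description precedes it below -/
import Mathlib

section
/- Let n, s, c, m be natural numbers with s ≥ 1, 2·c + 2·s < n, and 2·m ≥ n − 2·c. Let S be a subset of Fin (n+s) with cardinality at most c, and let μ be the product measure (MeasureTheory.Measure.pi) of m independent copies of the uniform distribution on Fin (n+s). Then μ of the event {f : Fin m → Fin (n+s) | ∀ i, f i ∈ S} is at most 2^(−s) (as a value in the extended nonnegative reals / reals). (This is the probabilistic formulation of the paper's theorem that any adversary compromising up to c < n/2 − s devices forges an accepted efficient attestation report with probability at most 2^(−s).) -/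
open MeasureTheory

lemma ENNReal.natCast_div_le_two_inv {a b : ℕ} (h : 2 * a ≤ b) (hb : b ≠ 0) :
    (a : ENNReal) / b ≤ 2⁻¹ := by
  rw [ENNReal.div_le_iff (by exact_mod_cast hb) (ENNReal.natCast_ne_top b), mul_comm,
    ← div_eq_mul_inv, ENNReal.le_div_iff_mul_le (by simp) (by simp), mul_comm]
  exact_mod_cast h

lemma Measure.pi_forall_mem_le_pow {ι α : Type*} [Fintype ι] [MeasurableSpace α]
    (ν : Measure α) [SigmaFinite ν] (S : Set α) {p : ENNReal} (h : ν S ≤ p) :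
    Measure.pi (fun _ : ι => ν) {f | ∀ i, f i ∈ S} ≤ p ^ Fintype.card ι := by
  have hset : {f : ι → α | ∀ i, f i ∈ S} = Set.univ.pi fun _ => S := by
    ext f
    simp
  rw [hset, Measure.pi_pi, Finset.prod_const, Finset.card_univ]
  gcongr

theorem aggregation_security (n s c m : ℕ) (hs : s ≥ 1)
    (hc : 2 * c + 2 * s < n) (hm : 2 * m ≥ n - 2 * c)
    (S : Finset (Fin (n + s))) (hS : S.card ≤ c) :
    MeasureTheory.Measure.pi
        (fun _ : Fin m =>
          (@PMF.uniformOfFintype (Fin (n + s)) _ ⟨⟨0, by omega⟩⟩).toMeasure)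
        {f : Fin m → Fin (n + s) | ∀ i, f i ∈ S}
      ≤ (2 : ENNReal) ^ (-(s : ℝ)) := by
  have : Nonempty (Fin (n + s)) := ⟨⟨0, by omega⟩⟩
  have hν : (PMF.uniformOfFintype (Fin (n + s))).toMeasure (S : Set (Fin (n + s))) ≤ 2⁻¹ := by
    rw [PMF.toMeasure_uniformOfFintype_apply _ (Set.toFinite _).measurableSet]
    simpa using ENNReal.natCast_div_le_two_inv (a := S.card) (b := n + s) (by omega) (by omega)
  calc _ ≤ (2⁻¹ : ENNReal) ^ Fintype.card (Fin m) :=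
        Measure.pi_forall_mem_le_pow _ (S : Set (Fin (n + s))) hν
    _ ≤ 2⁻¹ ^ s := pow_le_pow_right_of_le_one' (by simp) (by rw [Fintype.card_fin]; omega)
    _ = 2 ^ (-(s : ℝ)) := by rw [ENNReal.rpow_neg, ENNReal.rpow_natCast, ENNReal.inv_pow]
end

section
/- Let V be a nonempty finite type, G a simple graph on V with decidable adjacency, f : V → ℕ an assignment of device identifiers, and g : ℕ → V → ℕ a function satisfying g 0 = f and, for every k and every vertex v, g (k+1) v = min (g k v) (the minimum of g k u over all neighbors u of v, taken as g k v if v has no neighbors). Then for every k and every vertex v, g k v equals the minimum of f u over all vertices u with G.Reachable u v and G.dist u v ≤ k. (Hence after k rounds of the leader election protocol, each device stores the smallest identifier among all devices within graph distance k of it.) -/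
theorem SimpleGraph.exists_walk_length_le_iff {V : Type*} (G : SimpleGraph V) (u v : V) (k : ℕ) :
    (∃ p : G.Walk v u, p.length ≤ k) ↔ G.Reachable u v ∧ G.dist u v ≤ k := by
  constructor
  · rintro ⟨p, hp⟩
    exact ⟨p.reachable.symm, G.dist_comm ▸ (SimpleGraph.dist_le p).trans hp⟩
  · rintro ⟨hr, hd⟩
    obtain ⟨p, hp⟩ := hr.symm.exists_walk_length_eq_dist
    exact ⟨p, by rwa [hp, SimpleGraph.dist_comm]⟩

/-- Iterating minima over closed neighborhoods `k` times yields the minimum of the initial values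
over the endpoints of walks of length at most `k`. -/
theorem SimpleGraph.isLeast_of_iterate_inf'_neighborFinset {V α : Type*} [Fintype V]
    [DecidableEq V] [LinearOrder α] (G : SimpleGraph V) [DecidableRel G.Adj] (g : ℕ → V → α)
    (hg : ∀ k v, g (k + 1) v =
      (insert v (G.neighborFinset v)).inf' (Finset.insert_nonempty v _) (g k))
    (k : ℕ) (v : V) :
    IsLeast (g 0 '' {u | ∃ p : G.Walk v u, p.length ≤ k}) (g k v) := by
  induction k generalizing v with
  | zero =>
    refine ⟨⟨v, ⟨.nil, le_rfl⟩, rfl⟩, ?_⟩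
    rintro _ ⟨u, ⟨p, hp⟩, rfl⟩
    exact (congrArg (g 0) (p.eq_of_length_eq_zero (Nat.le_zero.mp hp))).le
  | succ k ih =>
    rw [hg]
    constructor
    · obtain ⟨w, hw, hmin⟩ := Finset.exists_mem_eq_inf' (Finset.insert_nonempty v _) (g k)
      rw [hmin]
      obtain ⟨u, ⟨p, hp⟩, hu⟩ := (ih w).1
      rcases Finset.mem_insert.mp hw with rfl | hw
      · exact ⟨u, ⟨p, hp.trans k.le_succ⟩, hu⟩
      · exact ⟨u, ⟨.cons ((G.mem_neighborFinset v w).mp hw) p, Nat.succ_le_succ hp⟩, hu⟩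
    · rintro _ ⟨u, ⟨p, hp⟩, rfl⟩
      cases p with
      | nil =>
        exact (Finset.inf'_le _ (Finset.mem_insert_self _ _)).trans
          ((ih _).2 ⟨_, ⟨.nil, Nat.zero_le k⟩, rfl⟩)
      | cons h q =>
        exact (Finset.inf'_le _ (Finset.mem_insert_of_mem ((G.mem_neighborFinset _ _).mpr h))).trans
          ((ih _).2 ⟨u, ⟨q, Nat.le_of_succ_le_succ hp⟩, rfl⟩)

theorem leader_election_rounds (V : Type*) [Nonempty V] [Fintype V] [DecidableEq V]
    (G : SimpleGraph V) [DecidableRel G.Adj]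
    (f : V → ℕ) (g : ℕ → V → ℕ) (hg0 : g 0 = f)
    (hgk : ∀ (k : ℕ) (v : V),
      g (k + 1) v =
        (insert v (G.neighborFinset v)).inf' (Finset.insert_nonempty v _) (g k)) :
    ∀ (k : ℕ) (v : V),
      g k v = sInf (f '' {u : V | G.Reachable u v ∧ G.dist u v ≤ k}) := by
  intro k v
  have h := G.isLeast_of_iterate_inf'_neighborFinset g hgk k v
  simp only [SimpleGraph.exists_walk_length_le_iff, hg0] at h
  exact h.csInf_eq.symm
end

section
/- Let V be a nonempty finite type, G a connected simple graph on V with decidable adjacency, f : V → ℕ an assignment of device identifiers, and g : ℕ → V → ℕ a function satisfying g 0 = f and, for every k and every vertex v, g (k+1) v = min (g k v) (the minimum of g k u over all neighbors u of v, taken as g k v if v has no neighbors). If k is a natural number such that G.dist u v ≤ k for all vertices u, v, then for every vertex v, g k v equals the minimum of f over all of V (i.e., the global minimum identifier). (Hence in a connected network the leader election protocol lets all devices agree on the device with the globally smallest identifier as the new leader within a number of rounds equal to the diameter of the network.) -/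
section MinPropagation

variable {V : Type*} [Fintype V] [DecidableEq V] {G : SimpleGraph V} [DecidableRel G.Adj]
  {g : ℕ → V → ℕ}

/-- Under min-propagation, the value stored at `v` after `k` rounds is at most the initial value
at the end of any walk of length at most `k` starting at `v`. -/
theorem minPropagation_le_of_walk
    (hgk : ∀ (k : ℕ) (v : V),
      g (k + 1) v =
        (insert v (G.neighborFinset v)).inf' (Finset.insert_nonempty v _) (g k))
    {k : ℕ} {v u : V} (p : G.Walk v u) (hp : p.length ≤ k) : g k v ≤ g 0 u := by
  induction k generalizing v with
  | zero => rw [SimpleGraph.Walk.eq_of_length_eq_zero (Nat.le_zero.mp hp)]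
  | succ k ih =>
    rw [hgk]
    cases p with
    | nil =>
      exact (Finset.inf'_le _ (Finset.mem_insert_self _ _)).trans
        (ih SimpleGraph.Walk.nil (Nat.zero_le k))
    | cons h q =>
      exact (Finset.inf'_le _ (Finset.mem_insert_of_mem
        ((G.mem_neighborFinset _ _).mpr h))).trans (ih q (Nat.le_of_succ_le_succ hp))

/-- Under min-propagation, every stored value is one of the initial values. -/
theorem minPropagation_mem_range
    (hgk : ∀ (k : ℕ) (v : V),
      g (k + 1) v =
        (insert v (G.neighborFinset v)).inf' (Finset.insert_nonempty v _) (g k))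
    (k : ℕ) (v : V) : g k v ∈ Set.range (g 0) := by
  induction k generalizing v with
  | zero => exact ⟨v, rfl⟩
  | succ k ih =>
    obtain ⟨w, -, hw⟩ := Finset.exists_mem_eq_inf'
      (Finset.insert_nonempty v (G.neighborFinset v)) (g k)
    rw [hgk, hw]
    exact ih w

end MinPropagation

theorem leader_election_agreement (V : Type*) [Nonempty V] [Fintype V] [DecidableEq V]
    (G : SimpleGraph V) (hG : G.Connected) [DecidableRel G.Adj]
    (f : V → ℕ) (g : ℕ → V → ℕ) (hg0 : g 0 = f)
    (hgk : ∀ (k : ℕ) (v : V),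
      g (k + 1) v =
        (insert v (G.neighborFinset v)).inf' (Finset.insert_nonempty v _) (g k))
    (k : ℕ) (hk : ∀ u v : V, G.dist u v ≤ k) :
    ∀ v : V, g k v = sInf (Set.range f) := by
  intro v
  subst hg0
  apply le_antisymm
  · obtain ⟨u, hu⟩ := Nat.sInf_mem (Set.range_nonempty (g 0))
    obtain ⟨p, hp⟩ := hG.exists_walk_length_eq_dist v u
    rw [← hu]
    exact minPropagation_le_of_walk hgk p (hp.trans_le (hk v u))
  · exact Nat.sInf_le (minPropagation_mem_range hgk k v)
end
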